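/- Let G be an amenable group, let X be an irreducible complete algebraic variety over an algebraically closed field K, let M ⊆ G be a finite subset and let f : X^M → X be a K-scheme morphism. For each field extension L/K, let X_L := X ×_K Spec(L) and let τ^(L) : X(L)^G → X(L)^G denote the algebraic cellular automaton over (G, X_L, L) with memory set M and local defining map f^(L) (induced by the base-changed morphism). If L is an algebraically closed extension of K, then τ^(K) is surjective if and only if τ^(L) is surjective. -/

import Mathlib

open AlgebraicGeometry CategoryTheory CategoryTheory.Limits Filter Topology
open scoped ENNReal NNReal

noncomputable section

namespace GOE

/-! ## Følner nets and amenability -/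

/-- A (right) Følner net for a group `G`: a net of nonempty finite subsets `F i ⊆ G`,
indexed by a directed nonempty preorder, such that `|F i \ F i g| / |F i| → 0` for every
`g ∈ G`. -/
structure FolnerNet (G : Type) [Group G] where
  ι : Type
  [pre : Preorder ι]
  [ne : Nonempty ι]
  [dir : IsDirected ι (· ≤ ·)]
  F : ι → Finset G
  nonempty : ∀ i, (F i).Nonempty
  folner : ∀ g : G,
    Filter.Tendsto
      (fun i => ((((F i : Set G) \ ((· * g) '' (F i : Set G))).ncard : ℝ) / ((F i).card : ℝ)))
      Filter.atTop (nhds 0)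

attribute [instance] FolnerNet.pre FolnerNet.ne FolnerNet.dir

/-- A group is amenable if it admits a Følner net. -/
def Amenable (G : Type) [Group G] : Prop := Nonempty (FolnerNet G)

/-! ## Constructible subsets of a topological space -/

/-- A subset of a topological space is constructible if it is a finite union of
locally closed subsets. -/
def IsConstr {X : Type} [TopologicalSpace X] (C : Set X) : Prop :=
  ∃ (n : ℕ) (U Z : Fin n → Set X), (∀ i, IsOpen (U i)) ∧ (∀ i, IsClosed (Z i)) ∧
    C = ⋃ i, U i ∩ Z i

/-- Conversion of a Krull dimension (an element of `WithBot ℕ∞`) to an extended real. -/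
def dimE (d : WithBot ℕ∞) : EReal :=
  WithBot.recBotCoe ⊥ (fun n : ℕ∞ => ((n : ℝ≥0∞) : EReal)) d

/-! ## Varieties over a field and their points -/

variable (K : Type) [Field K]

/-- The spectrum of the field `K`, as a scheme. -/
abbrev SpecK : Scheme := Spec (CommRingCat.of K)

/-- The unique point of `Spec K`. -/
def specPt : SpecK K := (⟨⊥, Ideal.bot_prime⟩ : PrimeSpectrum K)

instance : HasFiniteProducts (Over (SpecK K)) :=
  CategoryTheory.Over.ConstructProducts.over_finiteProducts_of_finiteWidePullbacks

/-- The set of `K`-points of a `K`-scheme, i.e. sections of the structure morphism,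
i.e. morphisms `Spec K ⟶ X` over `Spec K`. -/
abbrev Pt (W : Over (SpecK K)) : Type := Over.mk (𝟙 (SpecK K)) ⟶ W

/-- The image in (the underlying space of) `W` of a `K`-point of `W`. -/
def ev {W : Over (SpecK K)} (a : Pt K W) : W.left := a.left.base (specPt K)

/-- The fibered power `X^Ω` over `Spec K` of a `K`-scheme `X`, for a finite index set `Ω`. -/
def pow (V : Over (SpecK K)) (Ω : Type) [Finite Ω] : Over (SpecK K) :=
  ∏ᶜ (fun _ : Ω => V)

/-- The canonical identification of families of `K`-points indexed by `Ω` with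
`K`-points of the fibered power `X^Ω`. -/
def ptPow (V : Over (SpecK K)) (Ω : Type) [Finite Ω] (a : Ω → Pt K V) :
    Pt K (pow K V Ω) := Pi.lift a

variable (V : Over (SpecK K))

/-- The Krull dimension of (the underlying space of) a `K`-scheme. -/
def vdim : WithBot ℕ∞ := topologicalKrullDim V.left

/-- The Zariski topology on `A^Ω` (`A` the set of `K`-points of `X`), induced from the
Zariski topology of the fibered power `X^Ω` via the identification of `A^Ω` with a
subset (the set of closed points, for `K` algebraically closed) of `X^Ω`. -/
def cfgTop (Ω : Type) [Finite Ω] : TopologicalSpace (Ω → Pt K V) :=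
  TopologicalSpace.induced (fun u => ev K (ptPow K V Ω u)) inferInstance

/-- The Krull dimension of a subset `D ⊆ A^Ω` for the Zariski topology. -/
def cfgDim (Ω : Type) [Finite Ω] (D : Set (Ω → Pt K V)) : WithBot ℕ∞ :=
  letI := cfgTop K V Ω
  topologicalKrullDim D

/-- `D ⊆ A^Ω` is closed for the Zariski topology. -/
def cfgClosed (Ω : Type) [Finite Ω] (D : Set (Ω → Pt K V)) : Prop :=
  letI := cfgTop K V Ω
  IsClosed D

/-- `D ⊆ A^Ω` is constructible for the Zariski topology. -/
def cfgConstr (Ω : Type) [Finite Ω] (D : Set (Ω → Pt K V)) : Prop :=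
  letI := cfgTop K V Ω
  IsConstr D

/-! ## Configurations, restrictions, cylinders -/

variable {G : Type} [Group G]

/-- The restriction `Γ_Ω ⊆ A^Ω` of a set of configurations `Γ ⊆ A^G`. -/
def restr (Γ : Set (G → Pt K V)) (Ω : Finset G) : Set (↥Ω → Pt K V) :=
  (fun c (ω : ↥Ω) => c ω) '' Γ

/-- The cylinder `D_p ⊆ A^G`: configurations restricting to an element of `D` on `Ω` and
to `p` on `G ∖ Ω`. -/
def cyl (Ω : Finset G) (D : Set (↥Ω → Pt K V)) (p : {g : G // g ∉ Ω} → Pt K V) :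
    Set (G → Pt K V) :=
  {c | (fun ω : ↥Ω => c ω) ∈ D ∧ ∀ (g : G) (h : g ∉ Ω), c g = p ⟨g, h⟩}

/-- Algebraic mean dimension of `Γ ⊆ A^G` with respect to a Følner net. -/
def mdim (𝓕 : FolnerNet G) (Γ : Set (G → Pt K V)) : EReal :=
  Filter.limsup
    (fun i => dimE (cfgDim K V ↥(𝓕.F i) (restr K V Γ (𝓕.F i))) *
      ((((𝓕.F i).card : ℝ)⁻¹ : ℝ) : EReal))
    Filter.atTop

/-! ## Cellular automata -/

/-- `τ : A^G → A^G` is an algebraic cellular automaton over `(G, X, K)`: it admits a finite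
memory set `M ⊆ G` whose associated local defining map `A^M → A` is induced by a morphism
of `K`-schemes `f : X^M → X`. -/
def IsAlgCA (τ : (G → Pt K V) → (G → Pt K V)) : Prop :=
  ∃ (M : Finset G) (f : pow K V ↥M ⟶ V),
    ∀ (x : G → Pt K V) (g : G),
      τ x g = ptPow K V ↥M (fun m => x (g * (m : G))) ≫ f

/-- Pre-injectivity: configurations that are almost equal and have the same image are equal. -/
def PreInjective (τ : (G → Pt K V) → (G → Pt K V)) : Prop :=
  ∀ c₁ c₂ : G → Pt K V, {g : G | c₁ g ≠ c₂ g}.Finite → τ c₁ = τ c₂ → c₁ = c₂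

/-- `(*)`-pre-injectivity: there exist no finite subset `Ω ⊆ G` and Zariski-closed proper
subset `H ⊊ A^Ω` such that `τ((A^Ω)_p) = τ(H_p)` for all `p ∈ A^{G∖Ω}`. -/
def StarPreInjective (τ : (G → Pt K V) → (G → Pt K V)) : Prop :=
  ¬ ∃ (Ω : Finset G) (H : Set (↥Ω → Pt K V)), cfgClosed K V ↥Ω H ∧ H ≠ Set.univ ∧
      ∀ p : {g : G // g ∉ Ω} → Pt K V,
        τ '' cyl K V Ω Set.univ p = τ '' cyl K V Ω H p

/-- `(**)`-pre-injectivity: there is no finite subset `Ω ⊆ G` such that, for every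
`p ∈ A^{G∖Ω}`, the finite-support set `τ((A^Ω)_p)` (written as some `R_s`) satisfies
`dim(R) < dim(A^Ω)`. -/
def StarStarPreInjective (τ : (G → Pt K V) → (G → Pt K V)) : Prop :=
  ¬ ∃ Ω : Finset G, ∀ p : {g : G // g ∉ Ω} → Pt K V,
      ∃ (Λ : Finset G) (R : Set (↥Λ → Pt K V)) (s : {g : G // g ∉ Λ} → Pt K V),
        τ '' cyl K V Ω Set.univ p = cyl K V Λ R s ∧
        cfgDim K V ↥Λ R < cfgDim K V ↥Ω (Set.univ : Set (↥Ω → Pt K V))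

/-- `Γ ⊆ A^G` is closed for the prodiscrete topology on `A^G`. -/
def ProdiscreteClosed {A : Type} (Γ : Set (G → A)) : Prop :=
  letI : TopologicalSpace A := ⊥
  IsClosed Γ

/-- `Γ ⊆ A^G` is invariant under the shift action of `G`. -/
def ShiftInvariant {A : Type} (Γ : Set (G → A)) : Prop :=
  ∀ (g : G), ∀ c ∈ Γ, (fun h : G => c (g⁻¹ * h)) ∈ Γ

/-- An `(E,E')`-tiling of `G`. -/
def IsTiling (E E' : Finset G) (T : Set G) : Prop :=
  (∀ g ∈ T, ∀ h ∈ T, g ≠ h →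
    Disjoint ((g * ·) '' (E : Set G)) ((h * ·) '' (E : Set G))) ∧
  ∀ x : G, ∃ g ∈ T, x ∈ (g * ·) '' (E' : Set G)


section BaseChange

variable (K L : Type) [Field K] [Field L] [Algebra K L]

/-- The morphism `Spec L ⟶ Spec K` induced by the algebra map `K → L`. -/
def specMap : SpecK L ⟶ SpecK K := Spec.map (CommRingCat.ofHom (algebraMap K L))

/-- The base change functor from `K`-schemes to `L`-schemes. -/
def bc : Over (SpecK K) ⥤ Over (SpecK L) := Over.pullback (specMap K L)

instance : PreservesLimitsOfSize.{0, 0} (bc K L) :=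
  (Over.mapPullbackAdj (specMap K L)).rightAdjoint_preservesLimits

/-- Base change of a morphism `f : X^M → X` of `K`-schemes, as a morphism
`(X_L)^M → X_L` of `L`-schemes (via the canonical identification
`(X_L)^M ≅ (X^M)_L`). -/
def fBC {M : Type} [Finite M] (V : Over (SpecK K)) (f : pow K V M ⟶ V) :
    pow L ((bc K L).obj V) M ⟶ (bc K L).obj V :=
  (PreservesProduct.iso (bc K L) (fun _ : M => V)).inv ≫ (bc K L).map f

/-- The algebraic cellular automaton determined by a memory set `M` and a morphism
`f : X^M → X`. -/
def caOf {G : Type} [Group G] (V : Over (SpecK K)) (M : Finset G)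
    (f : pow K V ↥M ⟶ V) : (G → Pt K V) → (G → Pt K V) :=
  fun x g => ptPow K V ↥M (fun m => x (g * (m : G))) ≫ f

end BaseChange

/-- Compactness principle: nonempty closed conditions `D E` on compact spaces `P E` indexed by the
finite subsets `E` of `G`, compatible with restriction, are simultaneously satisfied by a family of
closed points of `X`, provided the coordinate maps `P E → X` are closed and continuous. -/
theorem exists_closedPoints_of_compatible {G X : Type*} [TopologicalSpace X] [T0Space X]
    [CompactSpace X] (P : Finset G → Type*) [∀ E, TopologicalSpace (P E)]
    [∀ E, CompactSpace (P E)] (π : ∀ (E : Finset G), ↥E → P E → X)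
    (hcont : ∀ E g, Continuous (π E g)) (hclosed : ∀ E g, IsClosedMap (π E g))
    (D : ∀ E, Set (P E)) (hD : ∀ E, IsClosed (D E)) (hne : ∀ E, (D E).Nonempty)
    (hres : ∀ (E E' : Finset G) (h : E ⊆ E'), ∀ z ∈ D E', ∃ w ∈ D E,
      ∀ g : ↥E, π E g w = π E' ⟨g, h g.2⟩ z) :
    ∃ x : G → closedPoints X, ∀ E, ∃ z ∈ D E, ∀ g : ↥E, π E g z = x g := by
  classical
  let sol (R : Set (G × closedPoints X)) (E : Finset G) : Set (P E) :=
    {z | z ∈ D E ∧ ∀ (g : ↥E) (a : closedPoints X), (g.1, a) ∈ R → π E g z = a}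
  have sol_closed (R E) : IsClosed (sol R E) := by
    have : sol R E = D E ∩ ⋂ (g : ↥E) (a : closedPoints X) (_ : (g.1, a) ∈ R),
        π E g ⁻¹' {(a : X)} := by
      ext z; simp [sol]
    rw [this]
    exact (hD E).inter <| isClosed_iInter fun g ↦ isClosed_iInter fun a ↦ isClosed_iInter fun _ ↦
      IsClosed.preimage (hcont E g) a.2
  have sol_res (R : Set (G × closedPoints X)) (E E' : Finset G) (h : E ⊆ E') (z : P E')
      (hz : z ∈ sol R E') : ∃ w ∈ sol R E, ∀ g : ↥E, π E g w = π E' ⟨g, h g.2⟩ z := by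
    obtain ⟨w, hw, hwz⟩ := hres E E' h z hz.1
    exact ⟨w, ⟨hw, fun g a ha ↦ (hwz g).trans (hz.2 ⟨g, h g.2⟩ a ha)⟩, hwz⟩
  have sol_anti {R R' : Set (G × closedPoints X)} (h : R ⊆ R') (E) : sol R' E ⊆ sol R E :=
    fun z hz ↦ ⟨hz.1, fun g a ha ↦ hz.2 g a (h ha)⟩
  obtain ⟨R, -, hR⟩ := zorn_subset_nonempty {R | ∀ E, (sol R E).Nonempty}
    (fun c hc hchain hcne ↦ ⟨⋃₀ c, fun E ↦ by
      have : Nonempty c := hcne.to_subtype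
      have hdir : Directed (· ⊇ ·) fun R : c ↦ sol R E := fun R R' ↦ by
        obtain h | h := hchain.total R.2 R'.2
        · exact ⟨R', sol_anti h E, subset_rfl⟩
        · exact ⟨R, subset_rfl, sol_anti h E⟩
      obtain ⟨z, hz⟩ := IsCompact.nonempty_iInter_of_directed_nonempty_isCompact_isClosed
        (fun R : c ↦ sol R E) hdir (fun R ↦ hc R.2 E) (fun R ↦ (sol_closed _ E).isCompact)
        (fun R ↦ sol_closed _ E)
      rw [Set.mem_iInter] at hz
      exact ⟨z, (hz (Classical.arbitrary c)).1, fun g a ⟨R, hRc, ha⟩ ↦ (hz ⟨R, hRc⟩).2 g a ha⟩,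
      fun R hRc ↦ Set.subset_sUnion_of_mem hRc⟩)
    ∅ (fun E ↦ (hne E).imp fun z hz ↦ ⟨hz, fun _ _ h ↦ h.elim⟩)
  have total (g : G) : ∃ a, (g, a) ∈ R := by
    let B (E : Finset G) : Set X :=
      π (insert g E) ⟨g, Finset.mem_insert_self g E⟩ '' sol R (insert g E)
    have B_closed (E) : IsClosed (B E) := hclosed _ _ _ (sol_closed _ _)
    have B_anti {E E' : Finset G} (h : E ⊆ E') : B E' ⊆ B E := by
      rintro _ ⟨z, hz, rfl⟩
      obtain ⟨w, hw, hwz⟩ := sol_res R _ _ (Finset.insert_subset_insert g h) z hz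
      exact ⟨w, hw, hwz _⟩
    have hdir : Directed (· ⊇ ·) B := fun E E' ↦
      ⟨E ∪ E', B_anti Finset.subset_union_left, B_anti Finset.subset_union_right⟩
    obtain ⟨a, ha, hac⟩ := (isClosed_iInter B_closed).exists_closed_singleton
      (IsCompact.nonempty_iInter_of_directed_nonempty_isCompact_isClosed B hdir
        (fun E ↦ (hR.prop _).image _) (fun E ↦ (B_closed E).isCompact) B_closed)
    rw [Set.mem_iInter] at ha
    refine ⟨⟨a, hac⟩, hR.le_of_ge (y := insert (g, ⟨a, hac⟩) R) (fun E ↦ ?_)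
      (Set.subset_insert _ _) (Set.mem_insert _ _)⟩
    obtain ⟨z, hz, hza⟩ := ha E
    obtain ⟨w, hw, hwz⟩ := sol_res R _ _ (Finset.subset_insert g E) z hz
    refine ⟨w, hw.1, fun h b hb ↦ ?_⟩
    obtain hb | hb := hb
    · obtain ⟨h, hE⟩ := h
      obtain ⟨rfl, rfl⟩ := Prod.mk.inj hb
      exact (hwz _).trans hza
    · exact hw.2 h b hb
  choose x hx using total
  exact ⟨x, fun E ↦ (hR.prop E).imp fun z hz ↦ ⟨hz.1, fun g ↦ hz.2 g _ (hx g)⟩⟩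

section Points

variable {K : Type} [Field K]

theorem ev_comp {W W' : Over (SpecK K)} (a : Pt K W) (g : W ⟶ W') :
    ev K (a ≫ g) = g.left (ev K a) := by
  simp [ev]

theorem ev_eq_apply_closedPoint {W : Over (SpecK K)} (a : Pt K W) :
    ev K a = a.left (IsLocalRing.closedPoint K) :=
  congrArg a.left (Subsingleton.elim (α := PrimeSpectrum K) _ _)

variable [IsAlgClosed K] {W : Over (SpecK K)} [LocallyOfFiniteType W.hom]

theorem isClosed_ev (a : Pt K W) : IsClosed {ev K a} := by
  rw [ev_eq_apply_closedPoint]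
  exact (pointEquivClosedPoint W.hom ⟨a.left, Over.w a⟩).2

theorem ev_injective : Function.Injective (ev K : Pt K W → W.left) := fun a b h ↦ by
  rw [ev_eq_apply_closedPoint, ev_eq_apply_closedPoint] at h
  exact Over.OverMorphism.ext <| ext_of_apply_closedPoint_eq W.hom (Over.w a) (Over.w b) h

theorem exists_ev_eq {z : W.left} (hz : IsClosed {z}) : ∃ a : Pt K W, ev K a = z :=
  ⟨Over.homMk (pointOfClosedPoint W.hom z hz) (by simp), pointOfClosedPoint_apply W.hom z hz _⟩

end Points

section Powers

variable {K : Type} [Field K]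

/-- The coordinate projections of a fibered power. -/
def powπ (V : Over (SpecK K)) {Ω : Type} [Finite Ω] (i : Ω) : pow K V Ω ⟶ V :=
  Pi.π (fun _ : Ω ↦ V) i

/-- The morphism into a fibered power given by its coordinates. -/
def powLift {V W : Over (SpecK K)} {Ω : Type} [Finite Ω] (g : Ω → (W ⟶ V)) : W ⟶ pow K V Ω :=
  Pi.lift g

@[simp]
theorem powLift_π {V W : Over (SpecK K)} {Ω : Type} [Finite Ω] (g : Ω → (W ⟶ V)) (i : Ω) :
    powLift g ≫ powπ V i = g i :=
  Pi.lift_π _ _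

theorem pow_hom_ext {V W : Over (SpecK K)} {Ω : Type} [Finite Ω] {a b : W ⟶ pow K V Ω}
    (h : ∀ i, a ≫ powπ V i = b ≫ powπ V i) : a = b :=
  Pi.hom_ext _ _ h

theorem comp_powLift {V W W' : Over (SpecK K)} {Ω : Type} [Finite Ω] (a : W' ⟶ W)
    (g : Ω → (W ⟶ V)) : a ≫ powLift g = powLift fun i ↦ a ≫ g i :=
  pow_hom_ext fun i ↦ by simp

theorem ptPow_π {V : Over (SpecK K)} {Ω : Type} [Finite Ω] (a : Ω → Pt K V) (i : Ω) :
    ptPow K V Ω a ≫ powπ V i = a i :=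
  Pi.lift_π _ _

instance isProper_pow_hom (V : Over (SpecK K)) [hV : IsProper V.hom] (Ω : Type) [Finite Ω] :
    IsProper (pow K V Ω).hom := by
  let P : ObjectProperty (Over (SpecK K)) := fun W ↦ IsProper W.hom
  have : P.IsClosedUnderIsomorphisms := ⟨fun {Y Z} e hY ↦ by
    have : IsProper Y.hom := hY
    have : IsIso e.inv.left := inferInstanceAs (IsIso ((Over.forget _).map e.inv))
    have : IsProper (e.inv.left ≫ Y.hom) := inferInstance
    rwa [Over.w] at this⟩
  have : P.IsClosedUnderLimitsOfShape (Discrete PEmpty.{1}) := .mk' <| by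
    rintro _ ⟨F, -⟩
    have e : limit F ≅ Over.mk (𝟙 (SpecK K)) :=
      HasLimit.isoOfNatIso F.uniqueFromEmpty ≪≫
        terminalIsTerminal.uniqueUpToIso Over.mkIdTerminal
    have : IsProper (𝟙 (SpecK K)) := inferInstance
    exact P.prop_of_iso e.symm this
  have prod (Y Z : Over (SpecK K)) (hY : P Y) (hZ : P Z) : P (Y ⨯ Z) := by
    have : IsProper Y.hom := hY
    have : IsProper Z.hom := hZ
    have sq := Over.isPullback_of_binaryFan_isLimit _ (prodIsProd Y Z)
    have : IsProper (prod.fst : Y ⨯ Z ⟶ Y).left :=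
      MorphismProperty.of_isPullback (P := @IsProper) sq.flip hZ
    have : IsProper ((prod.fst : Y ⨯ Z ⟶ Y).left ≫ Y.hom) := inferInstance
    rwa [Over.w] at this
  have : P.IsClosedUnderBinaryProducts := .mk' <| by
    rintro _ ⟨F, hF⟩
    exact P.prop_of_iso (HasLimit.isoOfNatIso (diagramIsoPair F)).symm (prod _ _ (hF _) (hF _))
  have : P.IsClosedUnderFiniteProducts := .mk'
  exact P.prop_product (f := fun _ : Ω ↦ V) fun _ ↦ hV

theorem isProper_left {W W' : Over (SpecK K)} [IsProper W.hom] [IsProper W'.hom] (g : W ⟶ W') :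
    IsProper g.left := by
  have : IsProper (g.left ≫ W'.hom) := by rwa [Over.w]
  exact .of_comp _ W'.hom

theorem compactSpace_left (W : Over (SpecK K)) [IsProper W.hom] : CompactSpace W.left :=
  (quasiCompact_iff_compactSpace W.hom).mp inferInstance

variable (V : Over (SpecK K)) {G : Type} [Group G] {M : Finset G} (f : pow K V ↥M ⟶ V)

/-- The morphism `X^E ⟶ X` computing the value at `g` of the cellular automaton with local map `f`
on a pattern with support `E ⊇ gM`. -/
def localMap (E : Finset G) (g : G) (h : ∀ m ∈ M, g * m ∈ E) : pow K V ↥E ⟶ V :=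
  powLift (fun m : ↥M ↦ powπ V (⟨g * m, h m m.2⟩ : ↥E)) ≫ f

/-- The morphism `X^E ⟶ X^F` induced by the cellular automaton with local map `f` on patterns with
support `E ⊇ FM`. -/
def patternMap (E F : Finset G) (h : ∀ g ∈ F, ∀ m ∈ M, g * m ∈ E) : pow K V ↥E ⟶ pow K V ↥F :=
  powLift fun g : ↥F ↦ localMap V f E g (h g g.2)

theorem patternMap_π (E F : Finset G) (h : ∀ g ∈ F, ∀ m ∈ M, g * m ∈ E) (g : ↥F) :
    patternMap V f E F h ≫ powπ V g = localMap V f E g (h g g.2) :=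
  powLift_π _ _

/-- Restriction of patterns from `E'` to `E ⊆ E'`. -/
def powRes {E E' : Finset G} (hE : E ⊆ E') : pow K V ↥E' ⟶ pow K V ↥E :=
  powLift fun g : ↥E ↦ powπ V (⟨g, hE g.2⟩ : ↥E')

theorem powRes_localMap {E E' : Finset G} (hE : E ⊆ E') (g : G) (h : ∀ m ∈ M, g * m ∈ E) :
    powRes V hE ≫ localMap V f E g h = localMap V f E' g fun m hm ↦ hE (h m hm) := by
  simp [localMap, powRes, ← Category.assoc, comp_powLift]

theorem comp_localMap (x : G → Pt K V) (E : Finset G) (g : G) (h : ∀ m ∈ M, g * m ∈ E)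
    (b : Pt K (pow K V ↥E)) (hb : ∀ e : ↥E, b ≫ powπ V e = x e) :
    b ≫ localMap V f E g h = caOf K V M f x g := by
  rw [localMap, caOf, ← Category.assoc, comp_powLift]
  simp only [hb]
  rfl

theorem surjective_caOf_iff [IsAlgClosed K] [IsProper V.hom] [Nonempty V.left] :
    Function.Surjective (caOf K V M f) ↔
      ∀ (E F : Finset G) (h : ∀ g ∈ F, ∀ m ∈ M, g * m ∈ E),
        Surjective (patternMap V f E F h).left := by
  classical
  have := compactSpace_left V
  constructor
  · intro hτ E F h
    have := isProper_left (patternMap V f E F h)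
    have : JacobsonSpace (pow K V ↥F).left :=
      LocallyOfFiniteType.jacobsonSpace (Y := Spec _) (pow K V ↥F).hom
    obtain ⟨v, -, hv⟩ := isClosed_univ.exists_closed_singleton (X := V.left) Set.univ_nonempty
    obtain ⟨a, -⟩ := exists_ev_eq hv
    refine ⟨Set.range_eq_univ.mp <| Set.univ_subset_iff.mp ?_⟩
    rw [← closure_closedPoints]
    refine closure_minimal (fun z hz ↦ ?_) (patternMap V f E F h).left.isClosedMap.isClosed_range
    obtain ⟨b, rfl⟩ := exists_ev_eq hz
    obtain ⟨x, hx⟩ := hτ fun g ↦ if hg : g ∈ F then b ≫ powπ V (⟨g, hg⟩ : ↥F) else a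
    refine ⟨ev K (ptPow K V ↥E fun e ↦ x e), ?_⟩
    rw [← ev_comp]
    congr 1
    refine pow_hom_ext fun g ↦ ?_
    rw [Category.assoc, patternMap_π, comp_localMap V f x _ _ _ _ fun e ↦ ptPow_π _ e, hx]
    exact dif_pos g.2
  · intro hf y
    have (E : Finset G) := compactSpace_left (pow K V ↥E)
    let D (E : Finset G) : Set (pow K V ↥E).left :=
      {z | ∀ g ∈ E, ∀ h : ∀ m ∈ M, g * m ∈ E, (localMap V f E g h).left z = ev K (y g)}
    have D_closed (E) : IsClosed (D E) := by
      have : D E = ⋂ (g : G) (_ : g ∈ E) (h : ∀ m ∈ M, g * m ∈ E),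
          (localMap V f E g h).left ⁻¹' {ev K (y g)} := by
        ext z; simp [D]
      rw [this]
      exact isClosed_iInter fun g ↦ isClosed_iInter fun _ ↦ isClosed_iInter fun h ↦
        (isClosed_ev (y g)).preimage (localMap V f E g h).left.continuous
    have D_nonempty (E) : (D E).Nonempty := by
      let F := {g ∈ E | ∀ m ∈ M, g * m ∈ E}
      have hF : ∀ g ∈ F, ∀ m ∈ M, g * m ∈ E := fun g hg ↦ (Finset.mem_filter.mp hg).2
      obtain ⟨z, hz⟩ := (hf E F hF).surj (ev K (ptPow K V ↥F fun g ↦ y g))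
      refine ⟨z, fun g hg h ↦ ?_⟩
      have hgF : g ∈ F := Finset.mem_filter.mpr ⟨hg, h⟩
      rw [← patternMap_π V f E F hF ⟨g, hgF⟩, Over.comp_left, Scheme.Hom.comp_apply, hz, ← ev_comp,
        ptPow_π]
    obtain ⟨x, hx⟩ := exists_closedPoints_of_compatible (fun E : Finset G ↦ (pow K V ↥E).left)
      (fun E g ↦ (powπ V g).left) (fun E g ↦ Scheme.Hom.continuous _)
      (fun E g ↦ have := isProper_left (powπ V g); Scheme.Hom.isClosedMap _)
      D D_closed D_nonempty fun E E' hE z hz ↦ by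
        refine ⟨(powRes V hE).left z, fun g hg h ↦ ?_, fun g ↦ ?_⟩
        · rw [← hz g (hE hg) fun m hm ↦ hE (h m hm), ← Scheme.Hom.comp_apply, ← Over.comp_left,
            powRes_localMap]
        · rw [← Scheme.Hom.comp_apply, ← Over.comp_left, powRes, powLift_π]
    choose c hc using fun g ↦ exists_ev_eq (x g).2
    refine ⟨c, funext fun g ↦ ev_injective ?_⟩
    let E : Finset G := insert g (M.image (g * ·))
    have hE : ∀ m ∈ M, g * m ∈ E := fun m hm ↦
      Finset.mem_insert_of_mem (Finset.mem_image_of_mem _ hm)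
    have closed : IsClosed (D E ∩ ⋂ e : ↥E, (powπ V e).left ⁻¹' {ev K (c e)}) :=
      (D_closed E).inter <| isClosed_iInter fun e ↦
        (isClosed_ev (c e)).preimage (powπ V e).left.continuous
    obtain ⟨z, ⟨hzD, hz⟩, hzc⟩ := closed.exists_closed_singleton <| by
      obtain ⟨z, hzD, hz⟩ := hx E
      exact ⟨z, hzD, Set.mem_iInter.mpr fun e ↦ (hz e).trans (hc e).symm⟩
    obtain ⟨b, rfl⟩ := exists_ev_eq hzc
    rw [← hzD g (Finset.mem_insert_self _ _) hE, ← ev_comp, comp_localMap V f c E g hE b]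
    intro e
    apply ev_injective
    rw [ev_comp]
    exact Set.mem_iInter.mp hz e

end Powers

section BaseChange

variable {K L : Type} [Field K] [Field L] [Algebra K L]

variable (L) in
/-- The projection from the base change of a `K`-scheme to the scheme itself. -/
def bcFst (W : Over (SpecK K)) : ((bc K L).obj W).left ⟶ W.left :=
  pullback.fst W.hom (specMap K L)

theorem isPullback_bcFst (W : Over (SpecK K)) :
    IsPullback (bcFst L W) ((bc K L).obj W).hom W.hom (specMap K L) :=
  IsPullback.of_hasPullback _ _

theorem isPullback_bc_map {W W' : Over (SpecK K)} (g : W ⟶ W') :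
    IsPullback (bcFst L W) ((bc K L).map g).left g.left (bcFst L W') := by
  refine IsPullback.of_bot ?_ ?_ (isPullback_bcFst W')
  · rw [Over.w, Over.w]
    exact isPullback_bcFst W
  · exact (pullback.lift_fst _ _ _).symm

instance surjective_bcFst (W : Over (SpecK K)) : Surjective (bcFst L W) :=
  have : Surjective (specMap K L) :=
    ⟨Function.surjective_to_subsingleton (α := PrimeSpectrum L) (β := PrimeSpectrum K) _⟩
  inferInstanceAs (Surjective (pullback.fst W.hom (specMap K L)))

theorem surjective_bc_map_left_iff {W W' : Over (SpecK K)} (g : W ⟶ W') :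
    Surjective ((bc K L).map g).left ↔ Surjective g.left := by
  have sq := isPullback_bc_map (L := L) g
  constructor
  · intro _
    have : Surjective (bcFst L W ≫ g.left) := by
      rw [sq.w]; infer_instance
    exact .of_comp (bcFst L W) g.left
  · intro h
    exact MorphismProperty.of_isPullback (P := @Surjective) sq h

/-- Base change commutes with fibered powers. -/
def bcPow (V : Over (SpecK K)) (Ω : Type) [Finite Ω] :
    (bc K L).obj (pow K V Ω) ≅ pow L ((bc K L).obj V) Ω :=
  PreservesProduct.iso (bc K L) fun _ : Ω ↦ V

@[simp]
theorem bcPow_hom_π (V : Over (SpecK K)) {Ω : Type} [Finite Ω] (i : Ω) :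
    (bcPow V Ω).hom ≫ powπ ((bc K L).obj V) i = (bc K L).map (powπ V i) :=
  piComparison_comp_π (bc K L) (fun _ : Ω ↦ V) i

instance isIso_bcPow_hom_left (V : Over (SpecK K)) (Ω : Type) [Finite Ω] :
    IsIso (bcPow (L := L) V Ω).hom.left :=
  inferInstanceAs (IsIso ((Over.forget _).map (bcPow V Ω).hom))

theorem patternMap_bc (V : Over (SpecK K)) {G : Type} [Group G] {M : Finset G}
    (f : pow K V ↥M ⟶ V) (E F : Finset G) (h : ∀ g ∈ F, ∀ m ∈ M, g * m ∈ E) :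
    (bcPow V ↥E).hom ≫ patternMap ((bc K L).obj V) (fBC K L V f) E F h =
      (bc K L).map (patternMap V f E F h) ≫ (bcPow V ↥F).hom := by
  refine pow_hom_ext fun g ↦ ?_
  have hf : fBC K L V f = (bcPow V ↥M).inv ≫ (bc K L).map f := rfl
  rw [Category.assoc, Category.assoc, patternMap_π, bcPow_hom_π, ← Functor.map_comp, patternMap_π,
    localMap, localMap, hf, Functor.map_comp, ← Category.assoc, ← Category.assoc]
  congr 1
  rw [Iso.comp_inv_eq]
  refine pow_hom_ext fun m ↦ ?_
  simp [← Functor.map_comp]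

end BaseChange

/-- Theorem 7.3, invariance of surjectivity under base change. Let `G`
be an amenable group, `X` an irreducible complete algebraic variety over an algebraically
closed field `K`, `M ⊆ G` a finite subset, and `f : X^M → X` a morphism of `K`-schemes.
For an algebraically closed field extension `L/K`, the algebraic cellular automaton
`τ^(K)` over `(G,X,K)` determined by `(M,f)` is surjective if and only if the algebraic
cellular automaton `τ^(L)` over `(G,X_L,L)` determined by `M` and the base change of `f`
is surjective. -/
theorem surjective_iff_surjective_baseChange
    (G : Type) [Group G] (hG : Amenable G)
    (K L : Type) [Field K] [Field L] [Algebra K L] [IsAlgClosed K] [IsAlgClosed L]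
    (V : Over (SpecK K)) (hft : LocallyOfFiniteType V.hom) (hqc : QuasiCompact V.hom)
    (hirr : IrreducibleSpace V.left) (hcomplete : IsProper V.hom)
    (M : Finset G) (f : pow K V ↥M ⟶ V) :
    Function.Surjective (caOf K V M f) ↔
      Function.Surjective (caOf L ((bc K L).obj V) M (fBC K L V f)) := by
  have : IsProper ((bc K L).obj V).hom :=
    MorphismProperty.of_isPullback (P := @IsProper) (isPullback_bcFst V) hcomplete
  have : Nonempty ((bc K L).obj V).left := (bcFst L V).surjective.nonempty
  rw [surjective_caOf_iff, surjective_caOf_iff]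
  refine forall₃_congr fun E F h ↦ ?_
  rw [← surjective_bc_map_left_iff (L := L), ← MorphismProperty.cancel_right_of_respectsIso
      @Surjective _ (bcPow V ↥F).hom.left, ← Over.comp_left, ← patternMap_bc, Over.comp_left,
    MorphismProperty.cancel_left_of_respectsIso @Surjective]
end GOE
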